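/- (Perturbed transversality, second Melnikov with difference.) Assume the unperturbed transversality bound: for all κ ∈ [κ₁, κ₂], all ℓ ∈ ℤ^ν and all j, j' ∈ S₀ᶜ with (ℓ, j, j') ≠ (0, j, j) and j⃗·ℓ + j − j' = 0, max over 0 ≤ n ≤ m₀ of |∂_κ^n(Ω⃗(κ)·ℓ + Ω_j(κ) − Ω_{j'}(κ))| ≥ ρ₀·⟨ℓ⟩. Then there exists δ > 0, depending only on 𝚑, g, γ, κ₁, κ₂, the tangential sites, C₀, τ, m₀ and ρ₀, such that if ε·υ^{−(1+m₀)} ≤ δ, then for all κ ∈ [κ₁, κ₂] and all such ℓ, j, j': max over 0 ≤ n ≤ m₀ of |∂_κ^n(ω⃗_ε(κ)·ℓ + μ_j(κ) − μ_{j'}(κ))| ≥ (ρ₀/2)·⟨ℓ⟩. -/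

import Mathlib

open Real Finset Set

/-- `G_j := j · tanh(dpt · j)` (finite depth `dpt`). -/
noncomputable def Gfun (dpt : ℝ) (j : ℤ) : ℝ := (j : ℝ) * Real.tanh (dpt * (j : ℝ))

/-- The linear frequencies `ω_j(κ)`. -/
noncomputable def omegaF (dpt g γ : ℝ) (j : ℤ) (κ : ℝ) : ℝ :=
  Real.sqrt (κ * Gfun dpt j * (j : ℝ) ^ 2 + g * Gfun dpt j + (γ * Gfun dpt j / (2 * (j : ℝ))) ^ 2)

/-- The linear frequencies `Ω_j(κ) = ω_j(κ) + (γ/2) G_j / j`. -/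
noncomputable def OmegaF (dpt g γ : ℝ) (j : ℤ) (κ : ℝ) : ℝ :=
  omegaF dpt g γ j κ + γ / 2 * Gfun dpt j / (j : ℝ)

/-- The perturbed frequencies μ_j(κ). -/
noncomputable def muF (dpt g γ : ℝ) (m32 m1 m12 : ℝ → ℝ) (r : ℤ → ℝ → ℝ) (j : ℤ) (κ : ℝ) : ℝ :=
  m32 κ * OmegaF dpt g γ j κ + m1 κ * (j : ℝ) + m12 κ * |(j : ℝ)| ^ ((1 : ℝ) / 2) + r j κ
theorem Gfun_pos {dpt : ℝ} (hdpt : 0 < dpt) {j : ℤ} (hj : j ≠ 0) : 0 < Gfun dpt j := by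
  unfold Gfun
  rw [Real.tanh_eq_sinh_div_cosh, ← mul_div_assoc]
  refine div_pos ?_ (Real.cosh_pos _)
  rcases lt_or_gt_of_ne hj with h | h
  · have h' : (j : ℝ) < 0 := by exact_mod_cast h
    exact mul_pos_of_neg_of_neg h' (Real.sinh_neg_iff.2 (mul_neg_of_pos_of_neg hdpt h'))
  · have h' : (0 : ℝ) < j := by exact_mod_cast h
    exact mul_pos h' (Real.sinh_pos_iff.2 (mul_pos hdpt h'))

theorem one_le_abs_intCast {j : ℤ} (hj : j ≠ 0) : (1 : ℝ) ≤ |(j : ℝ)| := by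
  exact_mod_cast Int.one_le_abs hj

theorem Gfun_le_sq (dpt : ℝ) {j : ℤ} (hj : j ≠ 0) : Gfun dpt j ≤ (j : ℝ) ^ 2 := by
  have h1 := one_le_abs_intCast hj
  calc Gfun dpt j ≤ |(j : ℝ)| * |Real.tanh (dpt * j)| := by
        rw [← abs_mul]; exact le_abs_self _
    _ ≤ |(j : ℝ)| * |(j : ℝ)| := by
        exact mul_le_mul_of_nonneg_left ((Real.abs_tanh_lt_one _).le.trans h1) (abs_nonneg _)
    _ = (j : ℝ) ^ 2 := by rw [← sq, sq_abs]

/-- The shift `β_j` for which `ω_j(κ)² = G_j j² (κ + β_j)`. -/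
noncomputable def freqShift (dpt g γ : ℝ) (j : ℤ) : ℝ :=
  (g * Gfun dpt j + (γ * Gfun dpt j / (2 * (j : ℝ))) ^ 2) / (Gfun dpt j * (j : ℝ) ^ 2)

theorem freqShift_nonneg {dpt g : ℝ} (γ : ℝ) (hdpt : 0 < dpt) (hg : 0 < g) {j : ℤ}
    (hj : j ≠ 0) : 0 ≤ freqShift dpt g γ j := by
  have := Gfun_pos hdpt hj
  unfold freqShift
  positivity

theorem freqShift_mul_sq_le {dpt g : ℝ} (γ : ℝ) (hdpt : 0 < dpt) {j : ℤ}
    (hj : j ≠ 0) : freqShift dpt g γ j * (j : ℝ) ^ 2 ≤ g + γ ^ 2 := by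
  have hG := Gfun_pos hdpt hj
  have hj' : (j : ℝ) ≠ 0 := by exact_mod_cast hj
  have hG2 : Gfun dpt j / (j : ℝ) ^ 2 ≤ 1 :=
    (div_le_one (by positivity)).2 (Gfun_le_sq dpt hj)
  have heq : freqShift dpt g γ j * (j : ℝ) ^ 2
      = g + γ ^ 2 / 4 * (Gfun dpt j / (j : ℝ) ^ 2) := by
    unfold freqShift
    field_simp
    ring
  rw [heq]
  nlinarith [sq_nonneg γ]

theorem freqShift_le {dpt g : ℝ} (γ : ℝ) (hdpt : 0 < dpt) (hg : 0 < g) {j : ℤ}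
    (hj : j ≠ 0) : freqShift dpt g γ j ≤ g + γ ^ 2 := by
  have h1 : (1 : ℝ) ≤ (j : ℝ) ^ 2 := by
    rw [← sq_abs]; exact one_le_pow₀ (one_le_abs_intCast hj)
  nlinarith [freqShift_nonneg γ hdpt hg hj, freqShift_mul_sq_le (g := g) γ hdpt hj]

theorem omegaF_eq {dpt : ℝ} (g γ : ℝ) (hdpt : 0 < dpt) {j : ℤ} (hj : j ≠ 0) :
    omegaF dpt g γ j = fun κ => Real.sqrt (Gfun dpt j * (j : ℝ) ^ 2) *
      (κ + freqShift dpt g γ j) ^ ((1 : ℝ) / 2) := by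
  have hG := Gfun_pos hdpt hj
  have hj' : (j : ℝ) ≠ 0 := by exact_mod_cast hj
  funext κ
  rw [← Real.sqrt_eq_rpow, ← Real.sqrt_mul (by positivity), omegaF]
  congr 1
  unfold freqShift
  field_simp
  ring

theorem omegaF_nonneg (dpt g γ : ℝ) (j : ℤ) (κ : ℝ) : 0 ≤ omegaF dpt g γ j κ :=
  Real.sqrt_nonneg _

theorem omegaF_le {dpt g : ℝ} (γ : ℝ) (hdpt : 0 < dpt) (hg : 0 < g) {j : ℤ} (hj : j ≠ 0)
    {κ κ₂ : ℝ} (hκ : 0 < κ) (hκ₂ : κ ≤ κ₂) :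
    omegaF dpt g γ j κ ≤ (j : ℝ) ^ 2 * Real.sqrt (κ₂ + (g + γ ^ 2)) := by
  have hG := Gfun_pos hdpt hj
  have hβ := freqShift_nonneg γ hdpt hg hj
  rw [omegaF_eq g γ hdpt hj]
  dsimp only
  rw [← Real.sqrt_eq_rpow]
  gcongr
  · rw [Real.sqrt_le_left (by positivity)]
    calc Gfun dpt j * (j : ℝ) ^ 2 ≤ (j : ℝ) ^ 2 * (j : ℝ) ^ 2 := by
          gcongr; exact Gfun_le_sq dpt hj
      _ = ((j : ℝ) ^ 2) ^ 2 := by ring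
  · exact freqShift_le γ hdpt hg hj

theorem contDiffAt_omegaF {dpt g : ℝ} (γ : ℝ) (hdpt : 0 < dpt) (hg : 0 < g) {j : ℤ}
    (hj : j ≠ 0) (n : ℕ) {κ : ℝ} (hκ : 0 < κ) : ContDiffAt ℝ n (omegaF dpt g γ j) κ := by
  have hβ := freqShift_nonneg γ hdpt hg hj
  rw [omegaF_eq g γ hdpt hj]
  refine contDiffAt_const.mul (ContDiffAt.rpow_const_of_ne (by fun_prop) (by positivity))

theorem contDiffAt_OmegaF {dpt g : ℝ} (γ : ℝ) (hdpt : 0 < dpt) (hg : 0 < g) {j : ℤ}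
    (hj : j ≠ 0) (n : ℕ) {κ : ℝ} (hκ : 0 < κ) : ContDiffAt ℝ n (OmegaF dpt g γ j) κ :=
  (contDiffAt_omegaF γ hdpt hg hj n hκ).add contDiffAt_const

theorem iteratedDeriv_omegaF {dpt g : ℝ} (γ : ℝ) (hdpt : 0 < dpt) (hg : 0 < g) {j : ℤ}
    (hj : j ≠ 0) (n : ℕ) {κ : ℝ} (hκ : 0 < κ) :
    iteratedDeriv n (omegaF dpt g γ j) κ = (descPochhammer ℝ n).eval (1 / 2) *
      (omegaF dpt g γ j κ * (κ + freqShift dpt g γ j)⁻¹ ^ n) := by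
  have hβ := freqShift_nonneg γ hdpt hg hj
  have hpos : 0 < κ + freqShift dpt g γ j := by positivity
  rw [omegaF_eq g γ hdpt hj, iteratedDeriv_const_mul_field,
    iteratedDeriv_comp_add_const n (fun x : ℝ => x ^ ((1 : ℝ) / 2)),
    iteratedDeriv_eq_iterate]
  dsimp only
  rw [iter_deriv_rpow_const, Real.rpow_sub_natCast hpos.ne', inv_pow]
  ring

theorem abs_half_vorticity_mul_le (dpt γ : ℝ) {j : ℤ} (hj : j ≠ 0) :
    |γ / 2 * Gfun dpt j / (j : ℝ)| ≤ |γ| / 2 := by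
  have hj' : (j : ℝ) ≠ 0 := by exact_mod_cast hj
  have : γ / 2 * Gfun dpt j / (j : ℝ) = γ / 2 * Real.tanh (dpt * j) := by
    unfold Gfun; field_simp
  rw [this, abs_mul, abs_div, abs_two]
  exact mul_le_of_le_one_right (by positivity) (Real.abs_tanh_lt_one _).le

theorem abs_OmegaF_le {dpt g : ℝ} (γ : ℝ) (hdpt : 0 < dpt) (hg : 0 < g) {j : ℤ} (hj : j ≠ 0)
    {κ κ₂ : ℝ} (hκ : 0 < κ) (hκ₂ : κ ≤ κ₂) :
    |OmegaF dpt g γ j κ| ≤ (j : ℝ) ^ 2 * Real.sqrt (κ₂ + (g + γ ^ 2)) + |γ| / 2 := by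
  refine (abs_add_le _ _).trans (add_le_add ?_ (abs_half_vorticity_mul_le dpt γ hj))
  rw [abs_of_nonneg (omegaF_nonneg _ _ _ _ _)]
  exact omegaF_le γ hdpt hg hj hκ hκ₂

theorem abs_inv_add_pow_sub_le {κ₁ κ β β' : ℝ} (n : ℕ) (hκ₁ : 0 < κ₁) (hκ : κ₁ ≤ κ)
    (hβ : 0 ≤ β) (hβ' : 0 ≤ β') :
    |(κ + β)⁻¹ ^ n - (κ + β')⁻¹ ^ n| ≤ n * κ₁⁻¹ ^ (n + 1) * |β - β'| := by
  have h1 : κ₁ ≤ κ + β := by linarith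
  have h2 : κ₁ ≤ κ + β' := by linarith
  have p1 : 0 < κ + β := by linarith
  have p2 : 0 < κ + β' := by linarith
  have i1 : (κ + β)⁻¹ ≤ κ₁⁻¹ := inv_anti₀ hκ₁ h1
  have i2 : (κ + β')⁻¹ ≤ κ₁⁻¹ := inv_anti₀ hκ₁ h2
  have hd : |(κ + β)⁻¹ - (κ + β')⁻¹| ≤ |β - β'| * κ₁⁻¹ ^ 2 := by
    have : (κ + β)⁻¹ - (κ + β')⁻¹ = (β' - β) * ((κ + β)⁻¹ * (κ + β')⁻¹) := by
      field_simp; ring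
    rw [this, abs_mul, abs_sub_comm, sq, abs_of_pos (a := (κ + β)⁻¹ * (κ + β')⁻¹) (by positivity)]
    gcongr
  rcases n with _ | n
  · simp
  calc _ ≤ |(κ + β)⁻¹ - (κ + β')⁻¹| * ((n + 1 : ℕ) : ℝ) *
        max |(κ + β)⁻¹| |(κ + β')⁻¹| ^ n := abs_pow_sub_pow_le _ _ _
    _ ≤ (|β - β'| * κ₁⁻¹ ^ 2) * ((n + 1 : ℕ) : ℝ) * κ₁⁻¹ ^ n := by
        rw [abs_of_pos (inv_pos.2 p1), abs_of_pos (inv_pos.2 p2)]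
        gcongr
        exact max_le i1 i2
    _ = _ := by ring

theorem omegaF_mul_abs_freqShift_sub_le {dpt g : ℝ} (γ : ℝ) (hdpt : 0 < dpt) (hg : 0 < g)
    {j j' : ℤ} (hj : j ≠ 0) (hj' : j' ≠ 0) (hjj : |(j' : ℝ)| ≤ |(j : ℝ)|)
    {κ κ₂ : ℝ} (hκ : 0 < κ) (hκ₂ : κ ≤ κ₂) :
    omegaF dpt g γ j' κ * |freqShift dpt g γ j - freqShift dpt g γ j'| ≤
      Real.sqrt (κ₂ + (g + γ ^ 2)) * (g + γ ^ 2) := by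
  have hsq : (j' : ℝ) ^ 2 ≤ (j : ℝ) ^ 2 := sq_le_sq.2 hjj
  have hb := freqShift_nonneg γ hdpt hg hj
  have hb' := freqShift_nonneg γ hdpt hg hj'
  have h1 := freqShift_mul_sq_le (g := g) γ hdpt hj
  have h2 := freqShift_mul_sq_le (g := g) γ hdpt hj'
  have h3 : freqShift dpt g γ j * (j' : ℝ) ^ 2 ≤ g + γ ^ 2 :=
    (mul_le_mul_of_nonneg_left hsq hb).trans h1
  have h4 : (j' : ℝ) ^ 2 * |freqShift dpt g γ j - freqShift dpt g γ j'| ≤ g + γ ^ 2 := by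
    have hs : (j' : ℝ) ^ 2 = |(j' : ℝ) ^ 2| := (abs_of_nonneg (sq_nonneg _)).symm
    rw [hs, ← abs_mul, abs_le]
    constructor <;> nlinarith [sq_nonneg (j' : ℝ), mul_nonneg hb (sq_nonneg (j' : ℝ)),
      mul_nonneg hb' (sq_nonneg (j' : ℝ))]
  calc _ ≤ (j' : ℝ) ^ 2 * Real.sqrt (κ₂ + (g + γ ^ 2)) *
        |freqShift dpt g γ j - freqShift dpt g γ j'| := by
        gcongr; exact omegaF_le γ hdpt hg hj' hκ hκ₂
    _ = Real.sqrt (κ₂ + (g + γ ^ 2)) *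
        ((j' : ℝ) ^ 2 * |freqShift dpt g γ j - freqShift dpt g γ j'|) := by ring
    _ ≤ _ := by gcongr

theorem exists_abs_iteratedDeriv_omegaF_sub_le {dpt g κ₁ κ₂ : ℝ} (γ : ℝ) (hdpt : 0 < dpt)
    (hg : 0 < g) (hκ₁ : 0 < κ₁) (n : ℕ) :
    ∃ K : ℝ, ∀ κ ∈ Set.Icc κ₁ κ₂, ∀ j j' : ℤ, j ≠ 0 → j' ≠ 0 →
      |iteratedDeriv n (omegaF dpt g γ j) κ - iteratedDeriv n (omegaF dpt g γ j') κ| ≤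
        K * (|omegaF dpt g γ j κ - omegaF dpt g γ j' κ| + 1) := by
  set c : ℝ := |(descPochhammer ℝ n).eval (1 / 2)|
  set Q : ℝ := n * κ₁⁻¹ ^ (n + 1) * (Real.sqrt (κ₂ + (g + γ ^ 2)) * (g + γ ^ 2))
  have hQ : 0 ≤ Q := by positivity
  refine ⟨c * (κ₁⁻¹ ^ n + Q), fun κ hκ j j' hj hj' => ?_⟩
  wlog hjj : |(j' : ℝ)| ≤ |(j : ℝ)| generalizing j j'
  · rw [abs_sub_comm, abs_sub_comm (omegaF dpt g γ j κ)]
    exact this j' j hj' hj (le_of_not_ge hjj)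
  have hκ0 : 0 < κ := hκ₁.trans_le hκ.1
  have hb := freqShift_nonneg γ hdpt hg hj
  have hb' := freqShift_nonneg γ hdpt hg hj'
  set β := freqShift dpt g γ j with hβ
  set β' := freqShift dpt g γ j' with hβ'
  set w := omegaF dpt g γ j κ with hw
  set w' := omegaF dpt g γ j' κ with hw'
  have hw0 : 0 ≤ w' := omegaF_nonneg _ _ _ _ _
  rw [iteratedDeriv_omegaF γ hdpt hg hj n hκ0, iteratedDeriv_omegaF γ hdpt hg hj' n hκ0,
    ← mul_sub, abs_mul, mul_assoc]
  refine mul_le_mul_of_nonneg_left ?_ (abs_nonneg _)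
  rw [← hβ, ← hβ', ← hw, ← hw']
  have hdec : w * (κ + β)⁻¹ ^ n - w' * (κ + β')⁻¹ ^ n =
      (w - w') * (κ + β)⁻¹ ^ n + w' * ((κ + β)⁻¹ ^ n - (κ + β')⁻¹ ^ n) := by ring
  have h1 : |(w - w') * (κ + β)⁻¹ ^ n| ≤ κ₁⁻¹ ^ n * |w - w'| := by
    rw [abs_mul, mul_comm, abs_of_nonneg (a := (κ + β)⁻¹ ^ n) (by positivity)]
    gcongr
    linarith [hκ.1]
  have h2 : |w' * ((κ + β)⁻¹ ^ n - (κ + β')⁻¹ ^ n)| ≤ Q := by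
    rw [abs_mul, abs_of_nonneg hw0]
    calc _ ≤ w' * (n * κ₁⁻¹ ^ (n + 1) * |β - β'|) := by
          gcongr; exact abs_inv_add_pow_sub_le n hκ₁ hκ.1 hb hb'
      _ = n * κ₁⁻¹ ^ (n + 1) * (w' * |β - β'|) := by ring
      _ ≤ Q := by
          refine mul_le_mul_of_nonneg_left ?_ (by positivity)
          exact omegaF_mul_abs_freqShift_sub_le γ hdpt hg hj hj' hjj hκ0 hκ.2
  have h3 : 0 ≤ κ₁⁻¹ ^ n := by positivity
  rw [hdec]
  refine (abs_add_le _ _).trans ?_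
  nlinarith [abs_nonneg (w - w')]

theorem exists_abs_iteratedDeriv_OmegaF_sub_le_of_le {dpt g κ₁ κ₂ : ℝ} (γ : ℝ) (hdpt : 0 < dpt)
    (hg : 0 < g) (hκ₁ : 0 < κ₁) (m : ℕ) :
    ∃ K : ℝ, 0 ≤ K ∧ ∀ n ≤ m, ∀ κ ∈ Set.Icc κ₁ κ₂, ∀ j j' : ℤ, j ≠ 0 → j' ≠ 0 →
      |iteratedDeriv n (fun κ' => OmegaF dpt g γ j κ' - OmegaF dpt g γ j' κ') κ| ≤
        K * (|OmegaF dpt g γ j κ - OmegaF dpt g γ j' κ| + 1) := by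
  choose K hK using
    exists_abs_iteratedDeriv_omegaF_sub_le (κ₂ := κ₂) γ hdpt hg hκ₁
  have hS : 0 ≤ ∑ n ∈ Finset.range (m + 1), |K n| := Finset.sum_nonneg fun _ _ => abs_nonneg _
  refine ⟨1 + (∑ n ∈ Finset.range (m + 1), |K n|) * (1 + |γ|), by positivity,
    fun n hn κ hκ j j' hj hj' => ?_⟩
  have hκ0 : 0 < κ := hκ₁.trans_le hκ.1
  set D := |OmegaF dpt g γ j κ - OmegaF dpt g γ j' κ| with hD
  have hD0 : 0 ≤ D := abs_nonneg _
  have hKn : |K n| ≤ ∑ n ∈ Finset.range (m + 1), |K n| :=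
    Finset.single_le_sum (f := fun n => |K n|) (fun _ _ => abs_nonneg _)
      (Finset.mem_range.2 (Nat.lt_succ_of_le hn))
  rcases Nat.eq_zero_or_pos n with rfl | hpos
  · rw [iteratedDeriv_zero, ← hD]
    have : 0 ≤ (∑ n ∈ Finset.range (m + 1), |K n|) * (1 + |γ|) := by positivity
    nlinarith
  have hΩ : ∀ i : ℤ, iteratedDeriv n (OmegaF dpt g γ i) κ =
      iteratedDeriv n (omegaF dpt g γ i) κ := fun i => by
    rw [← iteratedDeriv_const_add (f := omegaF dpt g γ i) hpos (γ / 2 * Gfun dpt i / (i : ℝ))]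
    congr 1
    funext x
    exact add_comm (omegaF dpt g γ i x) _
  rw [iteratedDeriv_fun_sub (contDiffAt_OmegaF γ hdpt hg hj n hκ0)
    (contDiffAt_OmegaF γ hdpt hg hj' n hκ0), hΩ, hΩ]
  have hw : |omegaF dpt g γ j κ - omegaF dpt g γ j' κ| ≤ D + |γ| := by
    have h1 := abs_le.1 (abs_half_vorticity_mul_le dpt γ hj)
    have h2 := abs_le.1 (abs_half_vorticity_mul_le dpt γ hj')
    have h3 := abs_le.1 hD.ge
    unfold OmegaF at h3
    rw [abs_le]
    constructor <;> linarith [h1.1, h1.2, h2.1, h2.2, h3.1, h3.2]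
  calc _ ≤ K n * (|omegaF dpt g γ j κ - omegaF dpt g γ j' κ| + 1) := hK n κ hκ j j' hj hj'
    _ ≤ |K n| * (D + |γ| + 1) := by
        gcongr
        exact le_abs_self _
    _ ≤ (∑ n ∈ Finset.range (m + 1), |K n|) * ((1 + |γ|) * (D + 1)) := by
        gcongr
        nlinarith [abs_nonneg γ]
    _ ≤ _ := by nlinarith

theorem abs_iteratedDeriv_mul_le {f h : ℝ → ℝ} {x a b : ℝ} {n : ℕ} (ha : 0 ≤ a)
    (hf : ContDiffAt ℝ n f x) (hh : ContDiffAt ℝ n h x)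
    (hfa : ∀ i ≤ n, |iteratedDeriv i f x| ≤ a) (hhb : ∀ i ≤ n, |iteratedDeriv i h x| ≤ b) :
    |iteratedDeriv n (fun y => f y * h y) x| ≤ 2 ^ n * (a * b) := by
  rw [iteratedDeriv_fun_mul hf hh]
  have hsum : (2 : ℝ) ^ n = ∑ i ∈ Finset.range (n + 1), (n.choose i : ℝ) := by
    exact_mod_cast (Nat.sum_range_choose n).symm
  rw [hsum, Finset.sum_mul]
  refine (Finset.abs_sum_le_sum_abs _ _).trans (Finset.sum_le_sum fun i hi => ?_)
  have hi' : i ≤ n := Nat.lt_succ_iff.1 (Finset.mem_range.1 hi)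
  rw [abs_mul, abs_mul, Nat.abs_cast, mul_assoc]
  gcongr
  · exact hfa i hi'
  · exact hhb _ (Nat.sub_le n i)

theorem abs_rpow_half_sub_le {x y : ℝ} (hx : 1 ≤ |x|) (hy : 1 ≤ |y|) :
    |(|x| ^ ((1 : ℝ) / 2) - |y| ^ ((1 : ℝ) / 2))| ≤ |x - y| := by
  rw [← Real.sqrt_eq_rpow, ← Real.sqrt_eq_rpow]
  have hsx : 1 ≤ Real.sqrt |x| := Real.one_le_sqrt.2 hx
  have hsy : 1 ≤ Real.sqrt |y| := Real.one_le_sqrt.2 hy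
  refine le_trans ?_ (abs_abs_sub_abs_le_abs_sub x y)
  have : |x| - |y| = (√|x| - √|y|) * (√|x| + √|y|) := by
    nlinarith [Real.mul_self_sqrt (abs_nonneg x), Real.mul_self_sqrt (abs_nonneg y)]
  rw [this, abs_mul]
  refine le_mul_of_one_le_right (abs_nonneg _) (le_trans ?_ (le_abs_self _))
  linarith

/-- Derivative bound for a perturbation all of whose coefficients are `η`-small. -/
theorem abs_iteratedDeriv_perturbation_le {ν n : ℕ} {m32 m1 m12 f r r' : ℝ → ℝ}
    {q : Fin ν → ℝ → ℝ} {x η X c e : ℝ} (ℓ : Fin ν → ℝ) (hη : 0 ≤ η)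
    (dm32 : ContDiffAt ℝ n m32 x) (dm1 : ContDiffAt ℝ n m1 x) (dm12 : ContDiffAt ℝ n m12 x)
    (df : ContDiffAt ℝ n f x) (dr : ContDiffAt ℝ n r x) (dr' : ContDiffAt ℝ n r' x)
    (dq : ∀ a, ContDiffAt ℝ n (q a) x)
    (bm32 : ∀ i ≤ n, |iteratedDeriv i m32 x| ≤ η) (bm1 : |iteratedDeriv n m1 x| ≤ η)
    (bm12 : |iteratedDeriv n m12 x| ≤ η) (bf : ∀ i ≤ n, |iteratedDeriv i f x| ≤ X)
    (br : |iteratedDeriv n r x| ≤ η) (br' : |iteratedDeriv n r' x| ≤ η)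
    (bq : ∀ a, |iteratedDeriv n (q a) x| ≤ η) :
    |iteratedDeriv n (fun y => m32 y * f y + m1 y * c + m12 y * e + (r y - r' y) +
      ∑ a, ℓ a * q a y) x| ≤ η * (2 ^ n * X + |c| + |e| + 2 + ∑ a, |ℓ a|) := by
  have d1 := dm32.mul df
  have d2 : ContDiffAt ℝ n (fun y => m1 y * c) x := dm1.mul contDiffAt_const
  have d3 : ContDiffAt ℝ n (fun y => m12 y * e) x := dm12.mul contDiffAt_const
  have d4 := dr.sub dr'
  have d5 : ∀ a, ContDiffAt ℝ n (fun y => ℓ a * q a y) x :=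
    fun a => contDiffAt_const.mul (dq a)
  have d5' : ContDiffAt ℝ n (fun y => ∑ a, ℓ a * q a y) x :=
    ContDiffAt.sum fun a _ => d5 a
  rw [iteratedDeriv_fun_add (((d1.add d2).add d3).add d4) d5',
    iteratedDeriv_fun_add ((d1.add d2).add d3) d4,
    iteratedDeriv_fun_add (d1.add d2) d3, iteratedDeriv_fun_add d1 d2,
    iteratedDeriv_mul_const_field, iteratedDeriv_mul_const_field,
    iteratedDeriv_fun_sub dr dr', iteratedDeriv_fun_sum fun a _ => d5 a]
  have b1 := abs_iteratedDeriv_mul_le hη dm32 df bm32 bf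
  have b2 : |iteratedDeriv n m1 x * c| ≤ η * |c| := by rw [abs_mul]; gcongr
  have b3 : |iteratedDeriv n m12 x * e| ≤ η * |e| := by rw [abs_mul]; gcongr
  have b4 : |iteratedDeriv n r x - iteratedDeriv n r' x| ≤ η + η :=
    (abs_sub _ _).trans (add_le_add br br')
  have b5 : |∑ a, iteratedDeriv n (fun y => ℓ a * q a y) x| ≤ η * ∑ a, |ℓ a| := by
    rw [Finset.mul_sum]
    refine (Finset.abs_sum_le_sum_abs _ _).trans (Finset.sum_le_sum fun a _ => ?_)
    rw [iteratedDeriv_const_mul_field, abs_mul, mul_comm]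
    exact mul_le_mul_of_nonneg_right (bq a) (abs_nonneg _)
  exact (abs_add_le _ _).trans ((add_le_add ((abs_add_le _ _).trans (add_le_add
    ((abs_add_le _ _).trans (add_le_add ((abs_add_le _ _).trans (add_le_add b1 b2)) b3))
    b4)) b5).trans (le_of_eq (by ring)))

/-- The scalar argument: a perturbation which is small relative to `D + L`, where `D` is the size
of the frequency difference, preserves transversality, since `D` large makes `U 0` large. -/
theorem exists_le_abs_of_small_perturbation {m : ℕ} {U F : ℕ → ℝ} {ρ D L W η A M : ℝ}
    (hρ : 0 < ρ) (hL : 1 ≤ L) (hM : M = 2 * (W + 1 + ρ)) (hD : 0 ≤ D) (hW : 0 ≤ W)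
    (hU : ∃ n ≤ m, ρ * L ≤ |U n|) (hU0 : D - W * L ≤ |U 0|)
    (hη : η * A * (M + 1) ≤ min (ρ / 2) (1 / 2))
    (hP : ∀ n ≤ m, |F n - U n| ≤ η * A * (D + L)) :
    ∃ n ≤ m, ρ / 2 * L ≤ |F n| := by
  have hM0 : 0 < M + 1 := by rw [hM]; positivity
  have hF : ∀ n, |U n| - |F n - U n| ≤ |F n| := fun n => by
    have := abs_sub_abs_le_abs_sub (U n) (F n)
    rw [abs_sub_comm] at this
    linarith
  rcases le_or_gt D (M * L) with h | h
  · obtain ⟨n, hn, hUn⟩ := hU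
    refine ⟨n, hn, ?_⟩
    have h1 : η * A * (D + L) ≤ ρ / 2 * L := by
      rcases le_or_gt (η * A) 0 with h0 | h0
      · exact (mul_nonpos_of_nonpos_of_nonneg h0 (by linarith)).trans (by positivity)
      calc η * A * (D + L) ≤ η * A * (M * L + L) := by gcongr
        _ = η * A * (M + 1) * L := by ring
        _ ≤ ρ / 2 * L := by
          gcongr
          exact hη.trans (min_le_left _ _)
    linarith [hP n hn, hF n]
  · refine ⟨0, Nat.zero_le _, ?_⟩
    have hηA : η * A ≤ 1 / 2 := by
      have := hη.trans (min_le_right _ _)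
      by_contra! hcon
      nlinarith
    have h1 : η * A * (D + L) ≤ 1 / 2 * (D + L) := by gcongr
    have h2 := hP 0 (Nat.zero_le _)
    have h3 := hF 0
    rw [hM] at h
    nlinarith

/-- Perturbed transversality, second Melnikov conditions with difference. -/
theorem perturbed_transversality_2nd_difference
    (dpt g γ κ₁ κ₂ : ℝ) (hdpt : 0 < dpt) (hg : 0 < g) (hκ₁ : 0 < κ₁) (hκ₁₂ : κ₁ < κ₂)
    (ν : ℕ) (hν : 1 ≤ ν) (jbar : Fin ν → ℤ)
    (hjne : ∀ a, jbar a ≠ 0)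
    (hjinj : Function.Injective fun a => |jbar a|)
    (m₀ : ℕ) (hm₀ : 1 ≤ m₀) (ρ₀ : ℝ) (hρ₀ : 0 < ρ₀) (C₀ : ℝ) (hC₀ : 0 < C₀)
    (τ : ℝ) (hτ : 1 ≤ τ)
    (htrans : ∀ κ ∈ Set.Icc κ₁ κ₂, ∀ ℓ : Fin ν → ℤ, ∀ j j' : ℤ,
      j ≠ 0 → (∀ a, j ≠ jbar a) → j' ≠ 0 → (∀ a, j' ≠ jbar a) →
      ¬(ℓ = 0 ∧ j = j') → (∑ a, jbar a * ℓ a) + j - j' = 0 →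
      ∃ n ≤ m₀, ρ₀ * max 1 ‖ℓ‖ ≤
        |iteratedDeriv n
          (fun κ' => (∑ a, (ℓ a : ℝ) * OmegaF dpt g γ (jbar a) κ')
            + OmegaF dpt g γ j κ' - OmegaF dpt g γ j' κ') κ|) :
    ∃ δ > (0 : ℝ), ∀ ε υ : ℝ, 0 < ε → ε < 1 → 0 < υ → υ < 1 →
      ∀ (m32 m1 m12 : ℝ → ℝ) (r : ℤ → ℝ → ℝ) (ωε : ℝ → Fin ν → ℝ),
      ContDiff ℝ m₀ m32 → ContDiff ℝ m₀ m1 → ContDiff ℝ m₀ m12 →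
      (∀ j : ℤ, j ≠ 0 → (∀ a, j ≠ jbar a) → ContDiff ℝ m₀ (r j)) →
      (∀ a, ContDiff ℝ m₀ fun κ => ωε κ a) →
      (∀ k ≤ m₀, ∀ κ ∈ Set.Icc κ₁ κ₂,
        |iteratedDeriv k (fun κ' => m32 κ' - 1) κ| ≤ C₀ * ε / υ ^ k ∧
        |iteratedDeriv k m1 κ| ≤ C₀ * ε / υ ^ k ∧
        |iteratedDeriv k m12 κ| ≤ C₀ * ε / υ ^ k ∧
        (∀ j : ℤ, j ≠ 0 → (∀ a, j ≠ jbar a) →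
          |iteratedDeriv k (r j) κ| ≤ C₀ * ε / υ ^ (1 + k)) ∧
        (∀ a, |iteratedDeriv k (fun κ' => ωε κ' a - OmegaF dpt g γ (jbar a) κ') κ| ≤
          C₀ * ε / υ ^ (1 + k))) →
      ε / υ ^ (1 + m₀) ≤ δ →
      ∀ κ ∈ Set.Icc κ₁ κ₂, ∀ ℓ : Fin ν → ℤ, ∀ j j' : ℤ,
        j ≠ 0 → (∀ a, j ≠ jbar a) → j' ≠ 0 → (∀ a, j' ≠ jbar a) →
        ¬(ℓ = 0 ∧ j = j') → (∑ a, jbar a * ℓ a) + j - j' = 0 →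
        ∃ n ≤ m₀, ρ₀ / 2 * max 1 ‖ℓ‖ ≤
          |iteratedDeriv n
            (fun κ' => (∑ a, (ℓ a : ℝ) * ωε κ' a)
              + muF dpt g γ m32 m1 m12 r j κ' - muF dpt g γ m32 m1 m12 r j' κ') κ| := by
  obtain ⟨K, hK0, hK⟩ := exists_abs_iteratedDeriv_OmegaF_sub_le_of_le (κ₂ := κ₂) γ hdpt hg hκ₁ m₀
  set J : ℝ := ∑ a, |(jbar a : ℝ)| with hJ
  have hJ0 : 0 ≤ J := Finset.sum_nonneg fun _ _ => abs_nonneg _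
  set W : ℝ := ∑ a, ((jbar a : ℝ) ^ 2 * Real.sqrt (κ₂ + (g + γ ^ 2)) + |γ| / 2) with hW
  have hW0 : 0 ≤ W := Finset.sum_nonneg fun _ _ => by positivity
  set A : ℝ := 2 ^ m₀ * K + 2 * J + 2 + ν with hA
  have hA0 : 0 < A := by positivity
  set M : ℝ := 2 * (W + 1 + ρ₀) with hM
  have hM0 : 0 < M + 1 := by positivity
  refine ⟨min (ρ₀ / 2) (1 / 2) / (C₀ * A * (M + 1)), by positivity, ?_⟩
  intro ε υ hε _ hυ hυ1 m32 m1 m12 r ωε dm32 dm1 dm12 dr dω hb hδ κ hκ ℓ j j' hj hjS hj' hjS'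
    hne hmom
  have hκ0 : 0 < κ := hκ₁.trans_le hκ.1
  set L : ℝ := max 1 ‖ℓ‖ with hL
  have hL1 : 1 ≤ L := le_max_left _ _
  have hℓ : ∀ a, |(ℓ a : ℝ)| ≤ L := fun a => by
    have h := norm_le_pi_norm ℓ a
    rw [Int.norm_eq_abs] at h
    exact h.trans (le_max_right _ _)
  set D : ℝ := |OmegaF dpt g γ j κ - OmegaF dpt g γ j' κ| with hD
  have hD0 : 0 ≤ D := abs_nonneg _
  set η : ℝ := C₀ * (ε / υ ^ (1 + m₀)) with hη
  have hη0 : 0 ≤ η := by positivity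
  have hsmall : ∀ k ≤ 1 + m₀, C₀ * ε / υ ^ k ≤ η := fun k hk => by
    rw [hη, mul_div_assoc]
    have := pow_le_pow_of_le_one hυ.le hυ1.le hk
    gcongr
  have hjj : |(j : ℝ) - j'| ≤ J * L := by
    have hmom' : (j : ℝ) - j' = -∑ a, (jbar a : ℝ) * ℓ a := by
      have : (∑ a, (jbar a : ℝ) * ℓ a) + j - j' = 0 := by exact_mod_cast hmom
      linarith
    rw [hmom', abs_neg, hJ, Finset.sum_mul]
    refine (Finset.abs_sum_le_sum_abs _ _).trans (Finset.sum_le_sum fun a _ => ?_)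
    rw [abs_mul]
    exact mul_le_mul_of_nonneg_left (hℓ a) (abs_nonneg _)
  have hsum : ∑ a, |(ℓ a : ℝ)| ≤ ν * L := by
    refine (Finset.sum_le_sum fun a _ => hℓ a).trans (le_of_eq ?_)
    simp
  have cΩ : ∀ (n : ℕ) {i : ℤ}, i ≠ 0 → ContDiffAt ℝ n (OmegaF dpt g γ i) κ :=
    fun n _ hi => contDiffAt_OmegaF γ hdpt hg hi n hκ0
  have cle : ∀ {n : ℕ} {f : ℝ → ℝ}, n ≤ m₀ → ContDiff ℝ m₀ f → ContDiffAt ℝ n f κ :=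
    fun hn hf => (hf.of_le (by exact_mod_cast hn)).contDiffAt
  refine exists_le_abs_of_small_perturbation (m := m₀) (D := D) (W := W) (η := η) (A := A)
    (U := fun n => iteratedDeriv n
          (fun κ' => (∑ a, (ℓ a : ℝ) * OmegaF dpt g γ (jbar a) κ')
            + OmegaF dpt g γ j κ' - OmegaF dpt g γ j' κ') κ)
    hρ₀ hL1 hM hD0 hW0 (htrans κ hκ ℓ j j' hj hjS hj' hjS' hne hmom) ?_ ?_ ?_
  · rw [iteratedDeriv_zero]
    have hlin : |∑ a, (ℓ a : ℝ) * OmegaF dpt g γ (jbar a) κ| ≤ W * L := by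
      rw [hW, Finset.sum_mul]
      refine (Finset.abs_sum_le_sum_abs _ _).trans (Finset.sum_le_sum fun a _ => ?_)
      rw [abs_mul, mul_comm]
      exact mul_le_mul (abs_OmegaF_le γ hdpt hg (hjne a) hκ0 hκ.2) (hℓ a) (abs_nonneg _)
        (by positivity)
    have h := abs_sub_abs_le_abs_sub (OmegaF dpt g γ j κ - OmegaF dpt g γ j' κ)
      (-∑ a, (ℓ a : ℝ) * OmegaF dpt g γ (jbar a) κ)
    rw [abs_neg, sub_neg_eq_add] at h
    calc D - W * L ≤ _ := sub_le_sub_left hlin D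
      _ ≤ _ := h
      _ = _ := by congr 1; ring
  · have h := mul_le_mul_of_nonneg_right hδ (by positivity : 0 ≤ C₀ * A * (M + 1))
    rw [div_mul_cancel₀ _ (by positivity)] at h
    calc η * A * (M + 1) = ε / υ ^ (1 + m₀) * (C₀ * A * (M + 1)) := by rw [hη]; ring
      _ ≤ _ := h
  · intro n hn
    have cU : ContDiffAt ℝ n (fun κ' => (∑ a, (ℓ a : ℝ) * OmegaF dpt g γ (jbar a) κ')
        + OmegaF dpt g γ j κ' - OmegaF dpt g γ j' κ') κ :=
      ((ContDiffAt.sum fun a _ => contDiffAt_const.mul (cΩ n (hjne a))).add (cΩ n hj)).sub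
        (cΩ n hj')
    have cmu : ∀ {i : ℤ}, i ≠ 0 → (∀ a, i ≠ jbar a) →
        ContDiffAt ℝ n (muF dpt g γ m32 m1 m12 r i) κ := fun hi hiS =>
      ((((cle hn dm32).mul (cΩ n hi)).add ((cle hn dm1).mul contDiffAt_const)).add
        ((cle hn dm12).mul contDiffAt_const)).add (cle hn (dr _ hi hiS))
    have cF : ContDiffAt ℝ n (fun κ' => (∑ a, (ℓ a : ℝ) * ωε κ' a)
        + muF dpt g γ m32 m1 m12 r j κ' - muF dpt g γ m32 m1 m12 r j' κ') κ :=
      ((ContDiffAt.sum fun a _ => contDiffAt_const.mul (cle hn (dω a))).add (cmu hj hjS)).sub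
        (cmu hj' hjS')
    rw [← iteratedDeriv_fun_sub cF cU]
    have hfun : (fun κ' => ((∑ a, (ℓ a : ℝ) * ωε κ' a)
        + muF dpt g γ m32 m1 m12 r j κ' - muF dpt g γ m32 m1 m12 r j' κ') -
        ((∑ a, (ℓ a : ℝ) * OmegaF dpt g γ (jbar a) κ')
            + OmegaF dpt g γ j κ' - OmegaF dpt g γ j' κ')) =
        fun κ' => (m32 κ' - 1) * (OmegaF dpt g γ j κ' - OmegaF dpt g γ j' κ')
          + m1 κ' * ((j : ℝ) - j')
          + m12 κ' * (|(j : ℝ)| ^ ((1 : ℝ) / 2) - |(j' : ℝ)| ^ ((1 : ℝ) / 2))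
          + (r j κ' - r j' κ')
          + ∑ a, (ℓ a : ℝ) * (ωε κ' a - OmegaF dpt g γ (jbar a) κ') := by
      funext κ'
      simp only [mul_sub, Finset.sum_sub_distrib, muF]
      ring
    rw [hfun]
    refine (abs_iteratedDeriv_perturbation_le (m32 := fun κ' => m32 κ' - 1)
      (q := fun a κ' => ωε κ' a - OmegaF dpt g γ (jbar a) κ') (X := K * (D + 1))
      (fun a => (ℓ a : ℝ)) hη0
      ((cle hn dm32).sub contDiffAt_const) (cle hn dm1) (cle hn dm12)
      ((cΩ n hj).sub (cΩ n hj')) (cle hn (dr j hj hjS)) (cle hn (dr j' hj' hjS'))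
      (fun a => (cle hn (dω a)).sub (cΩ n (hjne a)))
      (fun i hi => (hb i (hi.trans hn) κ hκ).1.trans (hsmall i (by omega)))
      ((hb n hn κ hκ).2.1.trans (hsmall n (by omega)))
      ((hb n hn κ hκ).2.2.1.trans (hsmall n (by omega)))
      (fun i hi => hK i (hi.trans hn) κ hκ j j' hj hj')
      (((hb n hn κ hκ).2.2.2.1 j hj hjS).trans (hsmall _ (by omega)))
      (((hb n hn κ hκ).2.2.2.1 j' hj' hjS').trans (hsmall _ (by omega)))
      (fun a => ((hb n hn κ hκ).2.2.2.2 a).trans (hsmall _ (by omega)))).trans ?_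
    rw [mul_assoc η]
    refine mul_le_mul_of_nonneg_left ?_ hη0
    have hroot := (abs_rpow_half_sub_le (one_le_abs_intCast hj) (one_le_abs_intCast hj')).trans hjj
    have hpow : (2 : ℝ) ^ n * (K * (D + 1)) ≤ 2 ^ m₀ * K * (D + L) := by
      rw [mul_assoc]
      gcongr
      norm_num
    have hrest : (2 * J + 2 + ν) * L ≤ (2 * J + 2 + ν) * (D + L) := by
      gcongr
      linarith
    rw [hA]
    linarith
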